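/- Assume p̄ = 1/2. There exist constants C, C' > 0 and y₀ < ∞ such that for all n ≥ 1, all y ≥ y₀, and every initial distribution η of the environment Markov chain, P_η(|Σ_{j=1}^n (G̃_j − 1)| > y) ≤ C (exp{−C' y²/(y ∨ 8n)} + exp{−C' y}). -/

import Mathlib

open MeasureTheory Filter Set Matrix ProbabilityTheory
open scoped Classical

noncomputable section

/-- `K` is a (row-)stochastic matrix. -/
def IsStochastic {n : Type*} [Fintype n] (K : Matrix n n ℝ) : Prop :=
  (∀ i j, 0 ≤ K i j) ∧ ∀ i, ∑ j, K i j = 1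

/-- `v` is a probability (row) vector. -/
def IsProbVec {n : Type*} [Fintype n] (v : n → ℝ) : Prop :=
  (∀ i, 0 ≤ v i) ∧ ∑ i, v i = 1

/-- `μ` is a stationary distribution for `K`, i.e. `μ K = μ`. -/
def IsStationaryDist {n : Type*} [Fintype n] (K : Matrix n n ℝ) (μ : n → ℝ) : Prop :=
  IsProbVec μ ∧ Matrix.vecMul μ K = μ

/-- `μ` is the unique stationary distribution of `K` (equivalent, for a finite chain, to `K`
having a unique closed irreducible subset). -/
def HasUniqueStationaryDist {n : Type*} [Fintype n] (K : Matrix n n ℝ) (μ : n → ℝ) : Prop :=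
  IsStationaryDist K μ ∧ ∀ μ' : n → ℝ, IsStationaryDist K μ' → μ' = μ

/-- `(Pm, Rc, ξ)` is the (averaged) law of the environment and coin tosses at a single site:
`Rc` is a Markov chain with transition matrix `K` and initial distribution `η`
(0-based indexing: `Rc j` is `R_{j+1}` of the paper) and, conditionally on the chain, the
`ξ j` are independent Bernoulli with success probability `p (Rc j)`. -/
def IsCookieSite {N : ℕ} {Ω : Type*} [MeasurableSpace Ω] (Pm : Measure Ω)
    (K : Matrix (Fin N) (Fin N) ℝ) (p η : Fin N → ℝ)
    (Rc : ℕ → Ω → Fin N) (ξ : ℕ → Ω → Bool) : Prop :=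
  (∀ j, Measurable (Rc j)) ∧ (∀ j, Measurable (ξ j)) ∧
    ∀ (m : ℕ) (f : ℕ → Fin N) (b : ℕ → Bool),
      (Pm {ω | ∀ j ≤ m, Rc j ω = f j ∧ ξ j ω = b j}).toReal =
        η (f 0) * (∏ j ∈ Finset.range m, K (f j) (f (j + 1))) *
          ∏ j ∈ Finset.range (m + 1), (if b j then p (f j) else 1 - p (f j))

/-- `numSucc ξx m` = number of successes before the `m`-th failure in the Bernoulli
sequence `ξx` (the quantity `S_m` of the paper). -/
def numSucc (ξx : ℕ → Bool) (m : ℕ) : ℕ :=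
  sInf {k | ((Finset.range (k + m)).filter fun j => ξx j = false).card = m}

/-- `numFail ξx m` = number of failures before the `m`-th success in the Bernoulli
sequence `ξx` (the quantity `F_m` of the paper). -/
def numFail (ξx : ℕ → Bool) (m : ℕ) : ℕ :=
  sInf {k | ((Finset.range (k + m)).filter fun j => ξx j = true).card = m}

/-- The forward branching-like process: `U_0 = y`, `U_i = S^i_{U_{i−1}}`. -/
def Uproc (ξ : ℤ → ℕ → Bool) (y : ℕ) : ℕ → ℕ
  | 0 => y
  | i + 1 => numSucc (ξ ((i : ℤ) + 1)) (Uproc ξ y i)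

/-- The backward branching-like process: `V_0 = y`, `V_i = F^i_{V_{i−1}+1}`. -/
def Vproc (ξ : ℤ → ℕ → Bool) (y : ℕ) : ℕ → ℕ
  | 0 => y
  | i + 1 => numFail (ξ ((i : ℤ) + 1)) (Vproc ξ y i + 1)

/-- A nonnegative left-invariant vector is proportional to the unique stationary distribution, so
it annihilates every function which the stationary distribution annihilates. -/
theorem HasUniqueStationaryDist.sum_mul_eq_zero_of_nonneg {n : Type*} [Fintype n]
    {K : Matrix n n ℝ} {μ f w : n → ℝ} (hμ : HasUniqueStationaryDist K μ)
    (hf : ∑ i, μ i * f i = 0) (hw : ∀ i, 0 ≤ w i) (hwK : w ᵥ* K = w) :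
    ∑ i, w i * f i = 0 := by
  rcases (Finset.sum_nonneg fun i _ => hw i).eq_or_lt' with h0 | hpos
  · rw [Finset.sum_eq_zero_iff_of_nonneg fun i _ => hw i] at h0
    exact Finset.sum_eq_zero fun i hi => by rw [h0 i hi, zero_mul]
  · have h := hμ.2 ((∑ i, w i)⁻¹ • w) ⟨⟨fun i => ?_, ?_⟩, ?_⟩
    · rw [← h] at hf
      simp only [Pi.smul_apply, smul_eq_mul, mul_assoc, ← Finset.mul_sum] at hf
      exact (mul_eq_zero.1 hf).resolve_left (inv_ne_zero hpos.ne')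
    · exact mul_nonneg (inv_nonneg.2 hpos.le) (hw i)
    · simp only [Pi.smul_apply, smul_eq_mul, ← Finset.mul_sum]
      exact inv_mul_cancel₀ hpos.ne'
    · rw [Matrix.smul_vecMul, hwK]

/-- The entrywise absolute value of a left-invariant vector of a stochastic matrix is
left-invariant. -/
theorem IsStochastic.abs_vecMul_eq {n : Type*} [Fintype n] {K : Matrix n n ℝ}
    (hK : IsStochastic K) {v : n → ℝ} (hv : v ᵥ* K = v) :
    (fun i => |v i|) ᵥ* K = fun i => |v i| := by
  have hle : ∀ j ∈ Finset.univ, |v j| ≤ ((fun i => |v i|) ᵥ* K) j := fun j _ => by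
    conv_lhs => rw [← hv]
    refine (Finset.abs_sum_le_sum_abs _ _).trans_eq (Finset.sum_congr rfl fun i _ => ?_)
    rw [abs_mul, abs_of_nonneg (hK.1 i j)]
  have hsum : ∑ j, |v j| = ∑ j, ((fun i => |v i|) ᵥ* K) j := by
    simp only [Matrix.vecMul, dotProduct]
    rw [Finset.sum_comm]
    simp only [← Finset.mul_sum, hK.2, mul_one]
  funext j
  exact (((Finset.sum_eq_sum_iff_of_le hle).1 hsum) j (Finset.mem_univ j)).symm

/-- Solvability of the Poisson equation of a finite chain with a unique stationary distribution. -/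
theorem HasUniqueStationaryDist.exists_poisson {n : Type*} [Fintype n] {K : Matrix n n ℝ}
    {μ f : n → ℝ} (hK : IsStochastic K) (hμ : HasUniqueStationaryDist K μ)
    (hf : ∑ i, μ i * f i = 0) : ∃ g : n → ℝ, g - K *ᵥ g = f := by
  by_contra hne
  have hmem : f ∉ LinearMap.range (LinearMap.id - K.mulVecLin) := by
    rintro ⟨g, hg⟩
    exact hne ⟨g, by simpa using hg⟩
  obtain ⟨φ, hφf, hφ⟩ := Submodule.exists_le_ker_of_notMem hmem
  set v : n → ℝ := fun i => φ fun j => if i = j then 1 else 0 with hvdef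
  have hφv : ∀ x : n → ℝ, φ x = ∑ i, v i * x i := fun x => by
    rw [LinearMap.pi_apply_eq_sum_univ φ x]
    exact Finset.sum_congr rfl fun i _ => by rw [smul_eq_mul, mul_comm]
  have hvK : v ᵥ* K = v := by
    funext j
    have h : φ (Pi.single j 1 - K *ᵥ Pi.single j 1) = 0 :=
      hφ ⟨Pi.single j 1, by simp⟩
    rw [hφv] at h
    simp only [Pi.sub_apply, mul_sub, Finset.sum_sub_distrib, Matrix.mulVec_single_one] at h
    simp only [Pi.single_apply, mul_ite, mul_one, mul_zero, Finset.sum_ite_eq',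
      Finset.mem_univ, if_true, Matrix.col_apply] at h
    simp only [Matrix.vecMul, dotProduct]
    linarith
  have habs := hK.abs_vecMul_eq hvK
  have h1 := hμ.sum_mul_eq_zero_of_nonneg hf (w := (fun i => |v i|) + v)
    (fun i => by simpa using neg_le_iff_add_nonneg'.1 (neg_abs_le (v i)))
    (by rw [Matrix.add_vecMul, habs, hvK])
  have h2 := hμ.sum_mul_eq_zero_of_nonneg hf (w := fun i => |v i|) (fun i => abs_nonneg _) habs
  simp only [Pi.add_apply, add_mul, Finset.sum_add_distrib, h2, zero_add] at h1
  exact hφf (by rw [hφv, h1])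

/-- A Hoeffding-type bound for small exponents. -/
theorem sum_mul_exp_le_of_abs_sub_le {ι : Type*} [Fintype ι] {w X : ι → ℝ} {m D l : ℝ}
    (hw : ∀ i, 0 ≤ w i) (hw1 : ∑ i, w i = 1) (hm : ∑ i, w i * X i = m)
    (hX : ∀ i, |X i - m| ≤ D) (hl : |l| * D ≤ 1) :
    ∑ i, w i * Real.exp (l * X i) ≤ Real.exp (l * m + l ^ 2 * D ^ 2) := by
  have hterm : ∀ i, Real.exp (l * X i) ≤
      Real.exp (l * m) * (1 + l * (X i - m) + l ^ 2 * D ^ 2) := fun i => by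
    have hsmall : |l * (X i - m)| ≤ |l| * D := by
      rw [abs_mul]
      exact mul_le_mul_of_nonneg_left (hX i) (abs_nonneg l)
    have hexp := (abs_le.1 (Real.abs_exp_sub_one_sub_id_le (hsmall.trans hl))).2
    have hsq : (l * (X i - m)) ^ 2 ≤ l ^ 2 * D ^ 2 := by
      rw [← mul_pow, sq_le_sq, abs_mul l D]
      exact hsmall.trans (mul_le_mul_of_nonneg_left (le_abs_self D) (abs_nonneg l))
    rw [show l * X i = l * m + l * (X i - m) by ring, Real.exp_add]
    exact mul_le_mul_of_nonneg_left (by linarith) (Real.exp_pos _).le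
  calc ∑ i, w i * Real.exp (l * X i)
      ≤ ∑ i, w i * (Real.exp (l * m) * (1 + l * (X i - m) + l ^ 2 * D ^ 2)) :=
        Finset.sum_le_sum fun i _ => mul_le_mul_of_nonneg_left (hterm i) (hw i)
    _ = Real.exp (l * m) * ((1 - l * m + l ^ 2 * D ^ 2) * ∑ i, w i + l * ∑ i, w i * X i) := by
        rw [Finset.mul_sum, Finset.mul_sum, ← Finset.sum_add_distrib, Finset.mul_sum]
        exact Finset.sum_congr rfl fun i _ => by ring
    _ = Real.exp (l * m) * (l ^ 2 * D ^ 2 + 1) := by rw [hw1, hm]; ring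
    _ ≤ Real.exp (l * m + l ^ 2 * D ^ 2) := by
        rw [Real.exp_add]
        exact mul_le_mul_of_nonneg_left (Real.add_one_le_exp _) (Real.exp_pos _).le

/-- The probability of the outcome `b` of a coin with success probability `q`. -/
def coinWeight (q : ℝ) (b : Bool) : ℝ := if b then q else 1 - q

/-- The centred outcome of a coin toss. -/
def centredCoin (b : Bool) : ℝ := if b then 1 / 2 else -1 / 2

theorem abs_centredCoin_le (b : Bool) : |centredCoin b| ≤ 1 / 2 := by
  unfold centredCoin
  split_ifs <;> norm_num [abs_le]

theorem coinWeight_nonneg {q : ℝ} (hq : q ∈ Set.Ioo (0 : ℝ) 1) (b : Bool) :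
    0 ≤ coinWeight q b := by
  unfold coinWeight
  split_ifs
  · exact hq.1.le
  · linarith [hq.2]

/-- The weight of a finite trajectory of the environment chain together with its coin tosses. -/
def pathWeight {N : ℕ} (K : Matrix (Fin N) (Fin N) ℝ) (p η : Fin N → ℝ) (m : ℕ)
    (x : Fin (m + 1) → Fin N × Bool) : ℝ :=
  η (x 0).1 * (∏ j : Fin m, K (x j.castSucc).1 (x j.succ).1) *
    ∏ j, coinWeight (p (x j).1) (x j).2

theorem pathWeight_snoc {N : ℕ} (K : Matrix (Fin N) (Fin N) ℝ) (p η : Fin N → ℝ) (m : ℕ)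
    (x : Fin (m + 1) → Fin N × Bool) (a : Fin N × Bool) :
    pathWeight K p η (m + 1) (Fin.snoc x a) =
      pathWeight K p η m x * (K (x (Fin.last m)).1 a.1 * coinWeight (p a.1) a.2) := by
  have h0 : (Fin.snoc x a : Fin (m + 2) → Fin N × Bool) 0 = x 0 := by
    rw [← Fin.castSucc_zero, Fin.snoc_castSucc (α := fun _ => Fin N × Bool)]
  unfold pathWeight
  rw [h0, Fin.prod_univ_castSucc, Fin.prod_univ_castSucc (n := m + 1)]
  simp only [Fin.succ_castSucc, Fin.snoc_castSucc (α := fun _ => Fin N × Bool), Fin.succ_last,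
    Fin.snoc_last (α := fun _ => Fin N × Bool)]
  ring

theorem pathWeight_nonneg {N : ℕ} {K : Matrix (Fin N) (Fin N) ℝ} {p η : Fin N → ℝ}
    (hK : IsStochastic K) (hp : ∀ i, p i ∈ Set.Ioo (0 : ℝ) 1) (hη : IsProbVec η) (m : ℕ)
    (x : Fin (m + 1) → Fin N × Bool) : 0 ≤ pathWeight K p η m x := by
  refine mul_nonneg (mul_nonneg (hη.1 _) (Finset.prod_nonneg fun j _ => hK.1 _ _))
    (Finset.prod_nonneg fun j _ => coinWeight_nonneg (hp _) _)

/-- One-step exponential bound, with the corrector `h` making the centred tosses a martingale. -/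
theorem sum_coin_exp_le {N : ℕ} {p h w : Fin N → ℝ} {m B D l : ℝ}
    (hp : ∀ i, p i ∈ Set.Ioo (0 : ℝ) 1) (hw : IsProbVec w)
    (hm : ∑ j, w j * (p j - 1 / 2 + h j) = m) (hB : ∀ i, |h i| ≤ B) (hmB : |m| ≤ B)
    (hD : D = 1 / 2 + 2 * B) (hl : |l| * D ≤ 1) :
    ∑ a : Fin N × Bool, w a.1 * coinWeight (p a.1) a.2 *
      Real.exp (l * (centredCoin a.2 + h a.1)) ≤ Real.exp (l * m + l ^ 2 * D ^ 2) := by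
  refine sum_mul_exp_le_of_abs_sub_le (fun a => mul_nonneg (hw.1 _) (coinWeight_nonneg (hp _) _))
    ?_ ?_ (fun a => ?_) hl
  · simp [Fintype.sum_prod_type, coinWeight, ← mul_add, hw.2]
  · rw [← hm, Fintype.sum_prod_type]
    refine Finset.sum_congr rfl fun j _ => ?_
    simp [coinWeight, centredCoin]
    ring
  · have h1 := abs_le.1 (hB a.1)
    have h2 := abs_le.1 hmB
    have h3 := abs_le.1 (abs_centredCoin_le a.2)
    rw [abs_le]
    constructor <;> linarith

/-- Exponential moment of the corrected sum of centred tosses, as a sum over trajectories. -/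
theorem sum_pathWeight_exp_le {N : ℕ} {K : Matrix (Fin N) (Fin N) ℝ} {p η h : Fin N → ℝ}
    {B D l : ℝ} (hK : IsStochastic K) (hp : ∀ i, p i ∈ Set.Ioo (0 : ℝ) 1) (hη : IsProbVec η)
    (hh : ∀ i, ∑ j, K i j * (p j - 1 / 2 + h j) = h i) (hB : ∀ i, |h i| ≤ B)
    (hD : D = 1 / 2 + 2 * B) (hl : |l| * D ≤ 1) (m : ℕ) :
    ∑ x : Fin (m + 1) → Fin N × Bool, pathWeight K p η m x *
        Real.exp (l * ((∑ j, centredCoin (x j).2) + h (x (Fin.last m)).1)) ≤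
      Real.exp (|l| * D + l ^ 2 * D ^ 2 * m) := by
  induction m with
  | zero =>
    rw [← (Equiv.funUnique (Fin 1) (Fin N × Bool)).symm.sum_comp]
    refine le_trans (b := ∑ a : Fin N × Bool, η a.1 * coinWeight (p a.1) a.2 *
      Real.exp (|l| * D)) (Finset.sum_le_sum fun a _ => ?_) (le_of_eq ?_)
    · have hw := pathWeight_nonneg hK hp hη 0 fun _ => a
      have hwa : pathWeight K p η 0 (fun _ => a) = η a.1 * coinWeight (p a.1) a.2 := by
        simp [pathWeight]
      have hsum : |∑ _j : Fin 1, centredCoin a.2 + h a.1| ≤ D := by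
        rw [Fin.sum_univ_one]
        exact (abs_add_le _ _).trans
          (by linarith [abs_centredCoin_le a.2, hB a.1, abs_nonneg (h a.1)])
      rw [← hwa]
      refine mul_le_mul_of_nonneg_left (Real.exp_le_exp.2 ((le_abs_self _).trans ?_)) hw
      rw [abs_mul]
      exact mul_le_mul_of_nonneg_left hsum (abs_nonneg l)
    · rw [← Finset.sum_mul]
      simp [Fintype.sum_prod_type, coinWeight, ← mul_add, hη.2]
  | succ m ih =>
    rw [← (Fin.snocEquiv fun _ : Fin (m + 2) => Fin N × Bool).sum_comp, Fintype.sum_prod_type,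
      Finset.sum_comm]
    calc _ = ∑ x : Fin (m + 1) → Fin N × Bool, pathWeight K p η m x *
          Real.exp (l * ∑ j, centredCoin (x j).2) *
          ∑ a : Fin N × Bool, K (x (Fin.last m)).1 a.1 * coinWeight (p a.1) a.2 *
            Real.exp (l * (centredCoin a.2 + h a.1)) := by
          refine Finset.sum_congr rfl fun x _ => ?_
          rw [Finset.mul_sum]
          refine Finset.sum_congr rfl fun a _ => ?_
          have hs : (Fin.snocEquiv fun _ : Fin (m + 2) => Fin N × Bool) (a, x) =
            (Fin.snoc x a : Fin (m + 2) → Fin N × Bool) := rfl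
          rw [hs, pathWeight_snoc, Fin.sum_univ_castSucc]
          simp only [Fin.snoc_castSucc (α := fun _ => Fin N × Bool),
            Fin.snoc_last (α := fun _ => Fin N × Bool)]
          rw [add_assoc, mul_add, Real.exp_add]
          ring
      _ ≤ ∑ x : Fin (m + 1) → Fin N × Bool, pathWeight K p η m x *
          Real.exp (l * ∑ j, centredCoin (x j).2) *
          Real.exp (l * h (x (Fin.last m)).1 + l ^ 2 * D ^ 2) :=
          Finset.sum_le_sum fun x _ => mul_le_mul_of_nonneg_left
            (sum_coin_exp_le hp ⟨hK.1 _, hK.2 _⟩ (hh _) hB (hB _) hD hl)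
            (mul_nonneg (pathWeight_nonneg hK hp hη m x) (Real.exp_pos _).le)
      _ = (∑ x : Fin (m + 1) → Fin N × Bool, pathWeight K p η m x *
          Real.exp (l * ((∑ j, centredCoin (x j).2) + h (x (Fin.last m)).1))) *
            Real.exp (l ^ 2 * D ^ 2) := by
          rw [Finset.sum_mul]
          refine Finset.sum_congr rfl fun x _ => ?_
          rw [mul_add, Real.exp_add, Real.exp_add]
          ring
      _ ≤ Real.exp (|l| * D + l ^ 2 * D ^ 2 * m) * Real.exp (l ^ 2 * D ^ 2) :=
          mul_le_mul_of_nonneg_right ih (Real.exp_pos _).le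
      _ = _ := by
          rw [← Real.exp_add]
          push_cast
          ring_nf

theorem IsCookieSite.measure_path {N : ℕ} {Ω : Type*} [MeasurableSpace Ω] {Pm : Measure Ω}
    {K : Matrix (Fin N) (Fin N) ℝ} {p η : Fin N → ℝ} {Rc : ℕ → Ω → Fin N} {ξ : ℕ → Ω → Bool}
    (hs : IsCookieSite Pm K p η Rc ξ) (m : ℕ) (x : Fin (m + 1) → Fin N × Bool) :
    Pm.real {ω | ∀ j : Fin (m + 1), (Rc j ω, ξ j ω) = x j} = pathWeight K p η m x := by
  have h := hs.2.2 m (fun j => (x (Fin.ofNat (m + 1) j)).1) (fun j => (x (Fin.ofNat (m + 1) j)).2)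
  have hx : ∀ j (hj : j < m + 1), Fin.ofNat (m + 1) j = ⟨j, hj⟩ := fun j hj =>
    Fin.ext (Nat.mod_eq_of_lt hj)
  convert h using 1
  · rw [Measure.real]
    congr 2
    ext ω
    simp only [Set.mem_ofPred_eq, Prod.ext_iff]
    constructor
    · intro H j hj
      rw [hx j (Nat.lt_succ_of_le hj)]
      exact H ⟨j, Nat.lt_succ_of_le hj⟩
    · intro H j
      have := H j (Nat.le_of_lt_succ j.2)
      rwa [hx j j.2] at this
  · rw [Finset.prod_range, Finset.prod_range, pathWeight]
    congr 1
    · congr 1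
      refine Finset.prod_congr rfl fun j _ => ?_
      rw [hx j (j.2.trans (Nat.lt_succ_self m)), hx (j + 1) (Nat.succ_lt_succ j.2)]
      rfl
    · refine Finset.prod_congr rfl fun j _ => ?_
      rw [hx j j.2]
      rfl

/-- Exponential tail bound for the centred number of successes in the first `T` tosses. -/
theorem IsCookieSite.measure_le_exp {N : ℕ} {Ω : Type*} [MeasurableSpace Ω] {Pm : Measure Ω}
    [IsProbabilityMeasure Pm] {K : Matrix (Fin N) (Fin N) ℝ} {p η h : Fin N → ℝ}
    {Rc : ℕ → Ω → Fin N} {ξ : ℕ → Ω → Bool} {B D l : ℝ} (hs : IsCookieSite Pm K p η Rc ξ)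
    (hK : IsStochastic K) (hp : ∀ i, p i ∈ Set.Ioo (0 : ℝ) 1) (hη : IsProbVec η)
    (hh : ∀ i, ∑ j, K i j * (p j - 1 / 2 + h j) = h i) (hB : ∀ i, |h i| ≤ B) (hB0 : 0 ≤ B)
    (hD : D = 1 / 2 + 2 * B) (hl : |l| * D ≤ 1) (T : ℕ) (s : ℝ) :
    Pm.real {ω | s ≤ l * ∑ j ∈ Finset.range T, centredCoin (ξ j ω)} ≤
      Real.exp (-s + 2 * (|l| * D) + l ^ 2 * D ^ 2 * T) := by
  have hD0 : 0 ≤ |l| * D := mul_nonneg (abs_nonneg l) (by linarith)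
  cases T with
  | zero =>
    by_cases hs0 : s ≤ 0
    · refine measureReal_le_one.trans (Real.one_le_exp ?_)
      simp only [Nat.cast_zero, mul_zero]
      linarith
    · simp [hs0, Real.exp_nonneg]
  | succ m =>
    set A : Finset (Fin (m + 1) → Fin N × Bool) :=
      Finset.univ.filter fun x => s ≤ l * ∑ j, centredCoin (x j).2
    have hsub : {ω | s ≤ l * ∑ j ∈ Finset.range (m + 1), centredCoin (ξ j ω)} ⊆
        ⋃ x ∈ A, {ω | ∀ j : Fin (m + 1), (Rc j ω, ξ j ω) = x j} := fun ω hω => by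
      rw [Set.mem_ofPred_eq, Finset.sum_range] at hω
      exact Set.mem_biUnion (x := fun j : Fin (m + 1) => (Rc j ω, ξ j ω))
        (by simpa [A] using hω) fun j => rfl
    calc _ ≤ ∑ x ∈ A, Pm.real {ω | ∀ j : Fin (m + 1), (Rc j ω, ξ j ω) = x j} :=
          (measureReal_mono hsub (measure_ne_top _ _)).trans (measureReal_biUnion_finset_le _ _)
      _ = ∑ x ∈ A, pathWeight K p η m x :=
          Finset.sum_congr rfl fun x _ => hs.measure_path m x
      _ ≤ ∑ x ∈ A, Real.exp (-s + |l| * D) * (pathWeight K p η m x *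
            Real.exp (l * ((∑ j, centredCoin (x j).2) + h (x (Fin.last m)).1))) := by
          refine Finset.sum_le_sum fun x hx => ?_
          have hxs : s ≤ l * ∑ j, centredCoin (x j).2 := (Finset.mem_filter.1 hx).2
          have hlh : -(|l| * D) ≤ l * h (x (Fin.last m)).1 := by
            refine (neg_le_neg ?_).trans (neg_abs_le _)
            rw [abs_mul]
            exact mul_le_mul_of_nonneg_left ((hB _).trans (by linarith)) (abs_nonneg l)
          rw [mul_left_comm, ← Real.exp_add]
          refine le_mul_of_one_le_right (pathWeight_nonneg hK hp hη m x) (Real.one_le_exp ?_)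
          linarith
      _ ≤ ∑ x, Real.exp (-s + |l| * D) * (pathWeight K p η m x *
            Real.exp (l * ((∑ j, centredCoin (x j).2) + h (x (Fin.last m)).1))) :=
          Finset.sum_le_univ_sum_of_nonneg fun x => mul_nonneg (Real.exp_pos _).le
            (mul_nonneg (pathWeight_nonneg hK hp hη m x) (Real.exp_pos _).le)
      _ ≤ Real.exp (-s + |l| * D) * Real.exp (|l| * D + l ^ 2 * D ^ 2 * m) := by
          rw [← Finset.mul_sum]
          exact mul_le_mul_of_nonneg_left (sum_pathWeight_exp_le hK hp hη hh hB hD hl m)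
            (Real.exp_pos _).le
      _ ≤ _ := by
          rw [← Real.exp_add, Real.exp_le_exp]
          push_cast
          nlinarith [mul_nonneg (sq_nonneg l) (sq_nonneg D)]

/-- The number of successes among the first `T` tosses. -/
def succCount (b : ℕ → Bool) (T : ℕ) : ℕ := ((Finset.range T).filter fun j => b j = true).card

theorem sum_centredCoin (b : ℕ → Bool) (T : ℕ) :
    ∑ j ∈ Finset.range T, centredCoin (b j) = (succCount b T : ℝ) - T / 2 := by
  induction T with
  | zero => simp [succCount]
  | succ T ih =>
    rw [Finset.sum_range_succ, ih, succCount, succCount, Finset.range_add_one,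
      Finset.filter_insert]
    cases hb : b T <;> simp [centredCoin] <;> ring

theorem succCount_le (b : ℕ → Bool) (T : ℕ) : succCount b T ≤ T := by
  simpa [succCount] using Finset.card_filter_le (Finset.range T) fun j => b j = true

theorem succCount_mono (b : ℕ → Bool) : Monotone (succCount b) := fun _ _ hst =>
  Finset.card_le_card (Finset.filter_subset_filter _ (Finset.range_mono hst))

theorem succCount_succ_le (b : ℕ → Bool) (T : ℕ) : succCount b (T + 1) ≤ succCount b T + 1 := by
  rw [succCount, succCount, Finset.range_add_one, Finset.filter_insert]
  split_ifs <;> simp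

theorem exists_succCount_eq {b : ℕ → Bool} {n k : ℕ} (h : n ≤ succCount b (k + n)) :
    ∃ i ≤ k, succCount b (i + n) = n := by
  induction k with
  | zero => exact ⟨0, le_rfl, le_antisymm (by simpa using succCount_le b n) (by simpa using h)⟩
  | succ k ih =>
    by_cases hk : n ≤ succCount b (k + n)
    · obtain ⟨i, hi, he⟩ := ih hk
      exact ⟨i, hi.trans k.le_succ, he⟩
    · refine ⟨k + 1, le_rfl, le_antisymm ?_ h⟩
      have := succCount_succ_le b (k + n)
      rw [show k + 1 + n = k + n + 1 by ring]
      omega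

theorem numFail_le {b : ℕ → Bool} {n k : ℕ} (h : n ≤ succCount b (k + n)) :
    numFail b n ≤ k ∧ succCount b (numFail b n + n) = n := by
  obtain ⟨i, hi, he⟩ := exists_succCount_eq h
  exact ⟨(Nat.sInf_le (s := {k | succCount b (k + n) = n}) he).trans hi,
    Nat.sInf_mem (s := {k | succCount b (k + n) = n}) ⟨i, he⟩⟩

/-- A large deviation of the number of failures forces a large deviation of the number of
successes at one of two deterministic times. -/
theorem succCount_of_lt_abs_numFail_sub {b : ℕ → Bool} {n : ℕ} {y : ℝ} (hy : 0 ≤ y)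
    (h : y < |(numFail b n : ℝ) - n|) :
    succCount b (2 * n + ⌊y⌋₊) < n ∨
      n ≤ succCount b ⌊2 * (n : ℝ) - y⌋₊ ∧ y ≤ 2 * n := by
  by_cases hlt : succCount b (2 * n + ⌊y⌋₊) < n
  · exact Or.inl hlt
  right
  rw [show 2 * n + ⌊y⌋₊ = (n + ⌊y⌋₊) + n by ring] at hlt
  obtain ⟨hle, heq⟩ := numFail_le (not_lt.1 hlt)
  have hfl := Nat.floor_le hy
  have hle' : (numFail b n : ℝ) ≤ n + ⌊y⌋₊ := mod_cast hle
  have hlow : (numFail b n : ℝ) + n < 2 * n - y := by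
    rcases lt_abs.1 h with h | h <;> linarith
  have h0 : (0 : ℝ) ≤ numFail b n := Nat.cast_nonneg _
  have h1 : (0 : ℝ) ≤ n := Nat.cast_nonneg _
  refine ⟨?_, by linarith⟩
  conv_lhs => rw [← heq]
  refine succCount_mono b (Nat.le_floor ?_)
  push_cast
  exact hlow.le

theorem sum_numFail_sub (b : ℕ → Bool) (n : ℕ) :
    ∑ j ∈ Finset.range n, ((numFail b (j + 1) : ℝ) - (numFail b j : ℝ) - 1) =
      (numFail b n : ℝ) - n := by
  have h0 : numFail b 0 = 0 := Nat.le_zero.1 (numFail_le (k := 0) (Nat.zero_le _)).1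
  rw [Finset.sum_sub_distrib, Finset.sum_range_sub (fun j => (numFail b j : ℝ)), h0]
  simp

/-- **Lemma A.1 (concentration for sums of failure counts, critical case `p̄ = 1/2`).**
There are constants `C, C' > 0` and `y₀ < ∞` such that for all `n ≥ 1`, all `y ≥ y₀` and
every initial distribution `η`,
`P_η(|Σ_{j=1}^n (G̃_j − 1)| > y) ≤ C (exp(−C' y²/(y ∨ 8n)) + exp(−C' y))`,
where `G̃_j = F_j − F_{j−1}` is the number of failures between the `(j−1)`-st and the `j`-th
success of the Bernoulli sequence at a site. -/
theorem failure_increment_sum_concentration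
    {N : ℕ} {Ω : Type*} [MeasurableSpace Ω]
    (K : Matrix (Fin N) (Fin N) ℝ) (μ p : Fin N → ℝ)
    (Rc : ℕ → Ω → Fin N) (ξ : ℕ → Ω → Bool)
    (Pfam : (Fin N → ℝ) → Measure Ω)
    (hK : IsStochastic K) (hμ : HasUniqueStationaryDist K μ)
    (hp : ∀ i, p i ∈ Set.Ioo (0 : ℝ) 1)
    (hcrit : ∑ i, μ i * p i = 1 / 2)
    (henv : ∀ η : Fin N → ℝ, IsProbVec η →
      IsProbabilityMeasure (Pfam η) ∧ IsCookieSite (Pfam η) K p η Rc ξ) :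
    ∃ C C' y₀ : ℝ, 0 < C ∧ 0 < C' ∧
      ∀ (n : ℕ), 1 ≤ n → ∀ y : ℝ, y₀ ≤ y → ∀ η : Fin N → ℝ, IsProbVec η →
        (Pfam η {ω | y <
            |∑ j ∈ Finset.range n,
              ((numFail (fun k => ξ k ω) (j + 1) : ℝ) - (numFail (fun k => ξ k ω) j : ℝ) -
                1)|}).toReal ≤
          C * (Real.exp (-C' * y ^ 2 / max y (8 * n)) + Real.exp (-C' * y)) := by
  obtain ⟨g, hg⟩ := hμ.exists_poisson hK (f := fun i => p i - 1 / 2) (by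
    simp only [mul_sub, Finset.sum_sub_distrib, ← Finset.sum_mul, hcrit, hμ.1.1.2]
    norm_num)
  set h : Fin N → ℝ := K *ᵥ g with hhdef
  have hh : ∀ i, ∑ j, K i j * (p j - 1 / 2 + h j) = h i := fun i => by
    rw [hhdef, Matrix.mulVec, dotProduct]
    refine Finset.sum_congr rfl fun j _ => ?_
    have := congrFun hg j
    simp only [Pi.sub_apply] at this
    rw [← this]
    ring
  set B : ℝ := ∑ i, |h i|
  have hB : ∀ i, |h i| ≤ B := fun i =>
    Finset.single_le_sum (f := fun i => |h i|) (fun _ _ => abs_nonneg _) (Finset.mem_univ i)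
  have hB0 : 0 ≤ B := Finset.sum_nonneg fun i _ => abs_nonneg _
  obtain ⟨D, hD⟩ : ∃ D, D = 1 / 2 + 2 * B := ⟨_, rfl⟩
  have hDpos : 0 < D := by linarith
  obtain ⟨ε, hε⟩ : ∃ ε, ε = 1 / (8 * D ^ 2) := ⟨_, rfl⟩
  have hεpos : 0 < ε := by rw [hε]; positivity
  have hεD : ε * D ^ 2 = 1 / 8 := by rw [hε]; field_simp
  have hεD1 : ε * D ≤ 1 := by nlinarith
  refine ⟨2 * Real.exp (ε / 2 + 2), ε / 4, 1, by positivity, by positivity,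
    fun n hn y hy η hη => ?_⟩
  obtain ⟨hprob, hs⟩ := henv η hη
  set M : ℝ := max y (8 * n)
  have hyM : y ≤ M := le_max_left _ _
  have hnM : 8 * (n : ℝ) ≤ M := le_max_right _ _
  have hMpos : 0 < M := by linarith
  obtain ⟨l, hl⟩ : ∃ l, l = ε * (y / M) := ⟨_, rfl⟩
  have hyM1 : y / M ≤ 1 := (div_le_one hMpos).2 hyM
  have hl0 : 0 ≤ l := by rw [hl]; positivity
  have hlε : l ≤ ε := by rw [hl]; exact mul_le_of_le_one_right hεpos.le hyM1
  have hlD : l * D ≤ 1 := (mul_le_mul_of_nonneg_right hlε hDpos.le).trans hεD1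
  have hbound : ∀ T : ℕ, (T : ℝ) ≤ 2 * M →
      Real.exp (-(l * ((y - 1) / 2)) + 2 * (l * D) + l ^ 2 * D ^ 2 * T) ≤
        Real.exp (ε / 2 + 2) * Real.exp (-(ε / 4) * y ^ 2 / M) := fun T hT => by
    rw [← Real.exp_add, Real.exp_le_exp]
    have h1 : l ^ 2 * D ^ 2 * T ≤ l ^ 2 * D ^ 2 * (2 * M) :=
      mul_le_mul_of_nonneg_left hT (by positivity)
    have h2 : l ^ 2 * D ^ 2 * (2 * M) = ε / 4 * (y ^ 2 / M) := by
      rw [hl, show (ε * (y / M)) ^ 2 * D ^ 2 * (2 * M) =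
        ε * (ε * D ^ 2) * 2 * ((y / M) ^ 2 * M) by ring, hεD]
      field_simp
      ring
    have h3 : l * y = ε * (y ^ 2 / M) := by rw [hl]; ring
    have h4 : -(ε / 4) * y ^ 2 / M = -(ε / 4 * (y ^ 2 / M)) := by ring
    rw [h4]
    linarith
  have hfl := Nat.floor_le (zero_le_one.trans hy)
  have hfl1 := Nat.lt_floor_add_one y
  have hT1 := hs.measure_le_exp (l := -l) hK hp hη hh hB hB0 hD
    (by rwa [abs_neg, abs_of_nonneg hl0]) (2 * n + ⌊y⌋₊) (l * ((y - 1) / 2))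
  have hT2 := hs.measure_le_exp (l := l) hK hp hη hh hB hB0 hD
    (by rwa [abs_of_nonneg hl0]) ⌊2 * (n : ℝ) - y⌋₊ (l * ((y - 1) / 2))
  rw [abs_neg, neg_sq, abs_of_nonneg hl0] at hT1
  rw [abs_of_nonneg hl0] at hT2
  replace hT1 := hT1.trans (hbound _ (by push_cast; linarith))
  replace hT2 := hT2.trans (hbound _ (by
    rcases le_or_gt 0 (2 * (n : ℝ) - y) with h0 | h0
    · linarith [Nat.floor_le h0]
    · rw [Nat.floor_of_nonpos h0.le]
      simpa using hMpos.le))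
  refine (measureReal_mono (μ := Pfam η) (fun ω hω => ?_)).trans
    ((measureReal_union_le _ _).trans ((add_le_add hT1 hT2).trans ?_))
  · rw [Set.mem_ofPred_eq, sum_numFail_sub] at hω
    simp only [Set.mem_union, Set.mem_ofPred_eq]
    rw [sum_centredCoin (fun k => ξ k ω), sum_centredCoin (fun k => ξ k ω)]
    rcases succCount_of_lt_abs_numFail_sub (zero_le_one.trans hy) hω with h1 | ⟨h1, h2⟩
    · left
      have h1' : (succCount (fun k => ξ k ω) (2 * n + ⌊y⌋₊) : ℝ) < n := mod_cast h1
      rw [neg_mul, ← mul_neg]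
      refine mul_le_mul_of_nonneg_left ?_ hl0
      push_cast
      linarith
    · right
      have h1' : (n : ℝ) ≤ succCount (fun k => ξ k ω) ⌊2 * (n : ℝ) - y⌋₊ := mod_cast h1
      refine mul_le_mul_of_nonneg_left ?_ hl0
      linarith [Nat.floor_le (sub_nonneg.2 h2)]
  · rw [mul_add, ← two_mul, mul_assoc 2]
    exact le_add_of_nonneg_right (by positivity)

end
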